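/- Let f : ι → ℝ^d be a finite family of n data points and let 𝒫_0, 𝒫_1, …, 𝒫_{n-1} be any sequence of partitions of the index set where 𝒫_0 consists of singletons and each 𝒫_k is obtained from 𝒫_{k-1} by merging two distinct blocks (A_k, B_k). Then the total sum of squared errors of the partition 𝒫_k, defined as SSE(𝒫_k) = Σ_{C ∈ 𝒫_k} SSE(C), equals the sum of the incremental merge costs: SSE(𝒫_k) = Σ_{j=1}^{k} Δ(A_j, B_j); in particular SSE(𝒫_k) is non-decreasing in k. -/

import Mathlib

open Finset

/-- The centroid of a finite cluster `C` of data points. -/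
noncomputable def centroid {ι : Type*} {d : ℕ} (f : ι → EuclideanSpace ℝ (Fin d))
    (C : Finset ι) : EuclideanSpace ℝ (Fin d) :=
  (C.card : ℝ)⁻¹ • ∑ i ∈ C, f i

/-- The within-cluster sum of squared errors of a cluster `C`. -/
noncomputable def SSE {ι : Type*} {d : ℕ} (f : ι → EuclideanSpace ℝ (Fin d))
    (C : Finset ι) : ℝ :=
  ∑ i ∈ C, ‖f i - centroid f C‖ ^ 2

/-- The Ward merge cost `Δ(A,B) = (|A|·|B|/(|A|+|B|)) · ‖μ(A) − μ(B)‖²`. -/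
noncomputable def wardCost {ι : Type*} {d : ℕ} (f : ι → EuclideanSpace ℝ (Fin d))
    (A B : Finset ι) : ℝ :=
  ((A.card : ℝ) * (B.card : ℝ) / ((A.card : ℝ) + (B.card : ℝ))) *
    ‖centroid f A - centroid f B‖ ^ 2

lemma SSE_eq_aux {ι : Type*} {d : ℕ} (f : ι → EuclideanSpace ℝ (Fin d))
    (C : Finset ι) (hC : C.Nonempty) :
    SSE f C = ∑ i ∈ C, ‖f i‖ ^ 2 - (C.card : ℝ)⁻¹ * ‖∑ i ∈ C, f i‖ ^ 2 := by
  have hc : (C.card : ℝ) ≠ 0 := by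
    have := hC.card_pos
    positivity
  unfold SSE _root_.centroid
  simp only [norm_sub_sq_real, Finset.sum_add_distrib, Finset.sum_sub_distrib, ← Finset.mul_sum,
    ← sum_inner, real_inner_smul_right, real_inner_self_eq_norm_sq, norm_smul, Finset.sum_const,
    nsmul_eq_mul, mul_pow, Real.norm_eq_abs, sq_abs]
  field_simp
  ring

lemma SSE_union_aux {ι : Type*} [DecidableEq ι] {d : ℕ} (f : ι → EuclideanSpace ℝ (Fin d))
    (A B : Finset ι) (hA : A.Nonempty) (hB : B.Nonempty) (h : Disjoint A B) :
    SSE f (A ∪ B) = SSE f A + SSE f B + wardCost f A B := by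
  have ha : 0 < (A.card : ℝ) := by exact_mod_cast hA.card_pos
  have hb : 0 < (B.card : ℝ) := by exact_mod_cast hB.card_pos
  rw [SSE_eq_aux f A hA, SSE_eq_aux f B hB, SSE_eq_aux f _ (hA.mono Finset.subset_union_left)]
  unfold wardCost _root_.centroid
  rw [Finset.sum_union h, Finset.sum_union h, Finset.card_union_of_disjoint h]
  push_cast
  generalize (A.card : ℝ) = a at *
  generalize (B.card : ℝ) = b at *
  rw [norm_add_sq_real, norm_sub_sq_real]
  simp only [real_inner_smul_left, real_inner_smul_right, norm_smul, mul_pow, Real.norm_eq_abs,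
    sq_abs]
  have : a + b ≠ 0 := by positivity
  field_simp
  ring

lemma wardCost_nonneg_aux {ι : Type*} {d : ℕ} (f : ι → EuclideanSpace ℝ (Fin d))
    (A B : Finset ι) : 0 ≤ wardCost f A B := by
  unfold wardCost
  positivity

/-- For any merging process `P 0, P 1, …, P (n-1)` starting from singletons, where
`P k` is obtained from `P (k-1)` by merging two distinct blocks `(A k, B k)`, the total
SSE of the partition equals the accumulated Ward merge costs:
`SSE(P k) = Σ_{j=1}^{k} Δ(A j, B j)`; in particular `SSE(P k)` is non-decreasing in `k`. -/
theorem SSE_partition_eq_sum_wardCost {ι : Type*} [DecidableEq ι] [Fintype ι] {d : ℕ}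
    (f : ι → EuclideanSpace ℝ (Fin d))
    (P : ℕ → Finset (Finset ι)) (A B : ℕ → Finset ι)
    (h0 : P 0 = Finset.univ.image (fun i => ({i} : Finset ι)))
    (hmem : ∀ k, 1 ≤ k → k ≤ Fintype.card ι - 1 →
      A k ∈ P (k - 1) ∧ B k ∈ P (k - 1) ∧ A k ≠ B k)
    (hstep : ∀ k, 1 ≤ k → k ≤ Fintype.card ι - 1 →
      P k = insert (A k ∪ B k) (((P (k - 1)).erase (A k)).erase (B k))) :
    (∀ k, k ≤ Fintype.card ι - 1 →
      ∑ C ∈ P k, SSE f C = ∑ j ∈ Finset.Icc 1 k, wardCost f (A j) (B j)) ∧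
    (∀ l m, l ≤ m → m ≤ Fintype.card ι - 1 →
      ∑ C ∈ P l, SSE f C ≤ ∑ C ∈ P m, SSE f C) := by
  have inv : ∀ k, k ≤ Fintype.card ι - 1 →
      (∀ C ∈ P k, C.Nonempty) ∧ (∀ C ∈ P k, ∀ D ∈ P k, C ≠ D → Disjoint C D) ∧
      ∑ C ∈ P k, SSE f C = ∑ j ∈ Finset.Icc 1 k, wardCost f (A j) (B j) := by
    intro k
    induction k with
    | zero =>
      intro _
      rw [h0]
      refine ⟨?_, ?_, ?_⟩
      · simp
      · simp only [Finset.mem_image, Finset.mem_univ, true_and]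
        rintro _ ⟨i, rfl⟩ _ ⟨j, rfl⟩ hij
        rw [Finset.disjoint_singleton]
        rintro rfl
        exact hij rfl
      · rw [Finset.sum_image (by intro i _ j _ hij; simpa using hij)]
        simp [SSE, _root_.centroid]
    | succ k ih =>
      intro hk
      obtain ⟨ne, dj, hs⟩ := ih (by omega)
      obtain ⟨hA, hB, hAB⟩ := hmem (k + 1) (by omega) hk
      have hP := hstep (k + 1) (by omega) hk
      rw [Nat.add_sub_cancel] at hA hB hP
      have hd := dj _ hA _ hB hAB
      have key : ∀ C ∈ ((P k).erase (A (k + 1))).erase (B (k + 1)),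
          Disjoint (A (k + 1) ∪ B (k + 1)) C := by
        intro C hC
        simp only [Finset.mem_erase] at hC
        rw [Finset.disjoint_union_left]
        exact ⟨dj _ hA _ hC.2.2 (Ne.symm hC.2.1), dj _ hB _ hC.2.2 (Ne.symm hC.1)⟩
      have hUne : (A (k + 1) ∪ B (k + 1)).Nonempty := (ne _ hA).mono Finset.subset_union_left
      have hnot : A (k + 1) ∪ B (k + 1) ∉ ((P k).erase (A (k + 1))).erase (B (k + 1)) := by
        intro hC
        have := key _ hC
        rw [disjoint_self] at this
        exact hUne.ne_empty this
      refine ⟨?_, ?_, ?_⟩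
      · intro C hC
        rw [hP, Finset.mem_insert] at hC
        rcases hC with rfl | hC
        · exact hUne
        · exact ne _ (Finset.mem_of_mem_erase (Finset.mem_of_mem_erase hC))
      · intro C hC D hD hCD
        rw [hP, Finset.mem_insert] at hC hD
        rcases hC with rfl | hC <;> rcases hD with rfl | hD
        · exact absurd rfl hCD
        · exact key _ hD
        · exact (key _ hC).symm
        · exact dj _ (Finset.mem_of_mem_erase (Finset.mem_of_mem_erase hC)) _
            (Finset.mem_of_mem_erase (Finset.mem_of_mem_erase hD)) hCD
      · rw [hP, Finset.sum_insert hnot, SSE_union_aux f _ _ (ne _ hA) (ne _ hB) hd,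
          Finset.sum_Icc_succ_top (by omega), ← hs,
          ← Finset.add_sum_erase (P k) (SSE f) hA,
          ← Finset.add_sum_erase ((P k).erase (A (k + 1))) (SSE f)
            (Finset.mem_erase.2 ⟨hAB.symm, hB⟩)]
        ring
  refine ⟨fun k hk => (inv k hk).2.2, fun l m hlm hm => ?_⟩
  rw [(inv l (hlm.trans hm)).2.2, (inv m hm).2.2]
  exact Finset.sum_le_sum_of_subset_of_nonneg (Finset.Icc_subset_Icc_right hlm)
    (fun _ _ _ => wardCost_nonneg_aux f _ _)
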